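/- arXiv:1608.07841 — 3 statements merged into one kernel-verified Lean document; each statement's English description precedes it below -/
import Mathlib

section
/- Suppose H has nonnegative entries, every row of H contains a strictly positive entry, and every column of H contains a strictly positive entry. Then for every x ∈ ℝ^N with strictly positive entries, the EM update conserves the total signal in the weighted sense: Σ_{j=1}^N (Hᵀ1)_j · T(x)_j = Σ_{i=1}^N y_i. -/
open Matrix

/-- The EM iteration map `T(x)_j = (x_j / (Hᵀ1)_j) · (Hᵀ(y/(Hx)))_j`. -/
noncomputable def emMap {N : ℕ} (H : Matrix (Fin N) (Fin N) ℝ) (y : Fin N → ℝ)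
    (x : Fin N → ℝ) : Fin N → ℝ :=
  fun j => x j / Hᵀ.mulVec 1 j * Hᵀ.mulVec (fun i => y i / H.mulVec x i) j

/-- The dot product of two nonnegative vectors, the second strictly positive, is positive as soon
as the first has a positive entry. -/
theorem dotProduct_pos_of_exists_pos {ι : Type*} [Fintype ι] {v w : ι → ℝ}
    (hv : ∀ i, 0 ≤ v i) (hpos : ∃ i, 0 < v i) (hw : ∀ i, 0 < w i) : 0 < v ⬝ᵥ w := by
  obtain ⟨i, hi⟩ := hpos
  exact Finset.sum_pos' (fun k _ => mul_nonneg (hv k) (hw k).le)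
    ⟨i, Finset.mem_univ i, mul_pos hi (hw i)⟩

/-- the EM update conserves the total signal in the weighted sense
`Σ_j (Hᵀ1)_j · T(x)_j = Σ_i y_i`. -/
theorem em_flux_conservation (N : ℕ) (H : Matrix (Fin N) (Fin N) ℝ)
    (y : Fin N → ℝ) (hy : ∀ i, 0 < y i)
    (hH : ∀ i j, 0 ≤ H i j)
    (hrow : ∀ i, ∃ j, 0 < H i j)
    (hcol : ∀ j, ∃ i, 0 < H i j) :
    ∀ x : Fin N → ℝ, (∀ j, 0 < x j) →
      ∑ j, Hᵀ.mulVec 1 j * emMap H y x j = ∑ i, y i := by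
  intro x hx
  have hcolsum : ∀ j, Hᵀ.mulVec 1 j ≠ 0 := fun j =>
    (dotProduct_pos_of_exists_pos (fun i => hH i j) (hcol j) (fun _ => one_pos)).ne'
  have hrowsum : ∀ i, H.mulVec x i ≠ 0 := fun i =>
    (dotProduct_pos_of_exists_pos (hH i) (hrow i) hx).ne'
  calc ∑ j, Hᵀ.mulVec 1 j * emMap H y x j
      = x ⬝ᵥ Hᵀ.mulVec (fun i => y i / H.mulVec x i) := by
        refine Finset.sum_congr rfl fun j _ => ?_
        rw [emMap, ← mul_assoc, mul_div_cancel₀ _ (hcolsum j)]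
    _ = H.mulVec x ⬝ᵥ fun i => y i / H.mulVec x i := by
        rw [dotProduct_mulVec, vecMul_transpose]
    _ = ∑ i, y i := Finset.sum_congr rfl fun i _ => mul_div_cancel₀ _ (hrowsum i)
end

section
/- First-order (Karush–Kuhn–Tucker) necessary conditions for the constrained maximum likelihood problem: suppose x* ∈ ℝ^N has nonnegative entries, satisfies (Hx*)_i > 0 for all i, and minimizes the Kullback–Leibler functional F over the nonnegative orthant { x ∈ ℝ^N : x_j ≥ 0 for all j, (Hx)_i > 0 for all i }. Then for every index j: (Hᵀ(1 − y/(Hx*)))_j ≥ 0, and the complementarity condition x*_j · (Hᵀ(1 − y/(Hx*)))_j = 0 holds. -/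
open Matrix

/-- The Kullback–Leibler functional `F(x) = Σᵢ [ yᵢ log(yᵢ/(Hx)ᵢ) + (Hx)ᵢ − yᵢ ]`. -/
noncomputable def klF {N : ℕ} (H : Matrix (Fin N) (Fin N) ℝ) (y : Fin N → ℝ)
    (x : Fin N → ℝ) : ℝ :=
  ∑ i, (y i * Real.log (y i / H.mulVec x i) + H.mulVec x i - y i)

/-- The directional derivative of the Kullback–Leibler functional is the dot product of the
direction with the gradient `Hᵀ(1 − y/(Hx))`. -/
theorem hasDerivAt_klF_line {N : ℕ} (H : Matrix (Fin N) (Fin N) ℝ) {y x : Fin N → ℝ}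
    (hy : ∀ i, 0 < y i) (hx : ∀ i, 0 < H.mulVec x i) (d : Fin N → ℝ) :
    HasDerivAt (fun t : ℝ => klF H y (x + t • d))
      (d ⬝ᵥ Hᵀ.mulVec (fun i => 1 - y i / H.mulVec x i)) 0 := by
  have hgrad : d ⬝ᵥ Hᵀ.mulVec (fun i => 1 - y i / H.mulVec x i) =
      ∑ i, (1 - y i / H.mulVec x i) * H.mulVec d i := by
    rw [Matrix.mulVec_transpose, dotProduct_comm, ← Matrix.dotProduct_mulVec]
    rfl
  rw [hgrad]
  unfold klF
  refine HasDerivAt.fun_sum fun i _ => ?_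
  have hline : HasDerivAt (fun t : ℝ => H.mulVec (x + t • d) i) (H.mulVec d i) 0 := by
    simpa [Matrix.mulVec_add, Matrix.mulVec_smul] using
      ((hasDerivAt_id (0 : ℝ)).mul_const (H.mulVec d i)).const_add (H.mulVec x i)
  have hx0 : H.mulVec (x + (0 : ℝ) • d) i = H.mulVec x i := by simp
  have hne : H.mulVec (x + (0 : ℝ) • d) i ≠ 0 := hx0 ▸ (hx i).ne'
  have hquot : y i / H.mulVec (x + (0 : ℝ) • d) i ≠ 0 := div_ne_zero (hy i).ne' hne
  have hder := (((((hasDerivAt_const (0 : ℝ) (y i)).fun_div hline hne).log hquot).const_mul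
    (y i)).add hline).sub_const (y i)
  refine hder.congr_deriv ?_
  rw [hx0]
  have h1 := (hx i).ne'
  have h2 := (hy i).ne'
  field_simp
  ring

/-- A function that is minimal at `a` among nearby points to the right of `a` has a
nonnegative derivative there. -/
theorem HasDerivAt.nonneg_of_eventually_le_right {f : ℝ → ℝ} {f' a : ℝ}
    (hf : HasDerivAt f f' a) (h : ∀ᶠ t in nhdsWithin a (Set.Ioi a), f a ≤ f t) : 0 ≤ f' := by
  have hslope := (hasDerivWithinAt_iff_tendsto_slope' Set.self_notMem_Ioi).1
    (hf.hasDerivWithinAt (s := Set.Ioi a))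
  refine ge_of_tendsto hslope ?_
  filter_upwards [h, self_mem_nhdsWithin] with t ht hat
  rw [slope_def_field]
  exact div_nonneg (sub_nonneg.2 ht) (sub_nonneg.2 (le_of_lt hat))

/-- Positivity of `Hx` persists under small perturbations along a line. -/
theorem eventually_mulVec_line_pos {N : ℕ} (H : Matrix (Fin N) (Fin N) ℝ) {x : Fin N → ℝ}
    (hx : ∀ i, 0 < H.mulVec x i) (d : Fin N → ℝ) :
    ∀ᶠ t : ℝ in nhds 0, ∀ i, 0 < H.mulVec (x + t • d) i := by
  refine Filter.eventually_all.2 fun i => ?_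
  have hcont : Continuous fun t : ℝ => H.mulVec (x + t • d) i := by
    simp only [Matrix.mulVec_add, Matrix.mulVec_smul, Pi.add_apply, Pi.smul_apply]
    fun_prop
  exact hcont.continuousAt.eventually (lt_mem_nhds (by simpa using hx i))

/-- KKT necessary conditions: if `x*` has nonnegative entries, `(Hx*)ᵢ > 0` for all
`i`, and `x*` minimizes the Kullback–Leibler functional over the nonnegative orthant
`{ x : xⱼ ≥ 0 ∀ j, (Hx)ᵢ > 0 ∀ i }`, then for every `j` the gradient component
`(Hᵀ(1 − y/(Hx*)))ⱼ` is nonnegative and the complementarity condition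
`x*ⱼ · (Hᵀ(1 − y/(Hx*)))ⱼ = 0` holds. -/
theorem kl_kkt_conditions (N : ℕ) (H : Matrix (Fin N) (Fin N) ℝ)
    (y : Fin N → ℝ) (hy : ∀ i, 0 < y i)
    (xstar : Fin N → ℝ)
    (hnonneg : ∀ j, 0 ≤ xstar j)
    (hpos : ∀ i, 0 < H.mulVec xstar i)
    (hmin : ∀ x : Fin N → ℝ, (∀ j, 0 ≤ x j) → (∀ i, 0 < H.mulVec x i) →
      klF H y xstar ≤ klF H y x) :
    ∀ j, 0 ≤ Hᵀ.mulVec (fun i => 1 - y i / H.mulVec xstar i) j ∧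
      xstar j * Hᵀ.mulVec (fun i => 1 - y i / H.mulVec xstar i) j = 0 := by
  intro j
  have hder := hasDerivAt_klF_line H hy hpos (Pi.single j 1)
  rw [single_one_dotProduct] at hder
  have hfeas : ∀ t : ℝ, 0 ≤ xstar j + t →
      ∀ k, 0 ≤ (xstar + t • (Pi.single j 1 : Fin N → ℝ)) k := by
    intro t ht k
    by_cases hk : k = j
    · subst hk
      simpa using ht
    · simpa [hk] using hnonneg k
  have hle : ∀ᶠ t : ℝ in nhds 0, 0 ≤ xstar j + t →
      klF H y (xstar + (0 : ℝ) • Pi.single j 1) ≤ klF H y (xstar + t • Pi.single j 1) := by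
    filter_upwards [eventually_mulVec_line_pos H hpos (Pi.single j 1)] with t ht hj
    simpa using hmin _ (hfeas t hj) ht
  constructor
  · refine hder.nonneg_of_eventually_le_right ?_
    filter_upwards [hle.filter_mono nhdsWithin_le_nhds, self_mem_nhdsWithin] with t ht h0
    exact ht (add_nonneg (hnonneg j) (le_of_lt h0))
  · rcases (hnonneg j).eq_or_lt with h0 | h0
    · rw [← h0, zero_mul]
    · have hmem : ∀ᶠ t : ℝ in nhds 0, -xstar j < t := lt_mem_nhds (neg_lt_zero.2 h0)
      have hlocal : IsLocalMin (fun t : ℝ => klF H y (xstar + t • Pi.single j 1)) 0 := by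
        filter_upwards [hle, hmem] with t ht hj
        exact ht (by linarith)
      rw [hlocal.hasDerivAt_eq_zero hder, mul_zero]
end

section
/- Monotone decrease of the Kullback–Leibler discrepancy along EM iterations: suppose H has nonnegative entries, every row of H contains a strictly positive entry, and every column of H contains a strictly positive entry. Then for every x ∈ ℝ^N with strictly positive entries, F(T(x)) ≤ F(x), where T is the EM iteration map. In particular, the sequence F(x_k) along EM iterates x_{k+1} = T(x_k) started from a strictly positive x_0 is nonincreasing. -/
open Matrix

section EM

variable {N : ℕ} {H : Matrix (Fin N) (Fin N) ℝ} {y x : Fin N → ℝ}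

theorem mulVec_apply_pos (hH : ∀ i j, 0 ≤ H i j) (hrow : ∀ i, ∃ j, 0 < H i j)
    (hx : ∀ j, 0 < x j) (i : Fin N) : 0 < H.mulVec x i := by
  obtain ⟨j, hj⟩ := hrow i
  exact Finset.sum_pos' (fun k _ => mul_nonneg (hH i k) (hx k).le)
    ⟨j, Finset.mem_univ j, mul_pos hj (hx j)⟩

theorem emMap_apply_pos (hy : ∀ i, 0 < y i) (hH : ∀ i j, 0 ≤ H i j)
    (hrow : ∀ i, ∃ j, 0 < H i j) (hcol : ∀ j, ∃ i, 0 < H i j) (hx : ∀ j, 0 < x j)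
    (j : Fin N) : 0 < emMap H y x j :=
  mul_pos
    (div_pos (hx j) (mulVec_apply_pos (fun i k => hH k i) hcol (fun _ => one_pos) j))
    (mulVec_apply_pos (fun i k => hH k i) hcol
      (fun i => div_pos (hy i) (mulVec_apply_pos hH hrow hx i)) j)

/-- Jensen's inequality for `log`, with the weights `H i j * x j / (H x) i`. -/
theorem sum_mul_log_div_le (hH : ∀ i j, 0 ≤ H i j) (hrow : ∀ i, ∃ j, 0 < H i j)
    (hx : ∀ j, 0 < x j) {z : Fin N → ℝ} (hz : ∀ j, 0 < z j) (i : Fin N) :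
    ∑ j, H i j * x j / H.mulVec x i * Real.log (z j / x j) ≤
      Real.log (H.mulVec z i / H.mulVec x i) := by
  have ha := mulVec_apply_pos hH hrow hx i
  have jensen := strictConcaveOn_log_Ioi.concaveOn.le_map_sum (t := Finset.univ)
    (w := fun j => H i j * x j / H.mulVec x i) (p := fun j => z j / x j)
    (fun j _ => div_nonneg (mul_nonneg (hH i j) (hx j).le) ha.le)
    (by rw [← Finset.sum_div]; exact div_self ha.ne')
    (fun j _ => div_pos (hz j) (hx j))
  have hsum : ∑ j, H i j * x j / H.mulVec x i * (z j / x j) =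
      H.mulVec z i / H.mulVec x i := by
    rw [show H.mulVec z i = ∑ j, H i j * z j from rfl, Finset.sum_div]
    refine Finset.sum_congr rfl fun j _ => ?_
    have := (hx j).ne'
    field_simp
  simpa only [smul_eq_mul, hsum] using jensen

theorem sum_mulVec (v : Fin N → ℝ) :
    ∑ i, H.mulVec v i = ∑ j, Hᵀ.mulVec 1 j * v j := by
  simp only [Matrix.mulVec, dotProduct, Matrix.transpose_apply, Pi.one_apply, mul_one,
    Finset.sum_mul]
  exact Finset.sum_comm

theorem klF_emMap_le (hy : ∀ i, 0 < y i) (hH : ∀ i j, 0 ≤ H i j)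
    (hrow : ∀ i, ∃ j, 0 < H i j) (hcol : ∀ j, ∃ i, 0 < H i j) (hx : ∀ j, 0 < x j) :
    klF H y (emMap H y x) ≤ klF H y x := by
  have hz := emMap_apply_pos hy hH hrow hcol hx
  have hs : ∀ j, 0 < Hᵀ.mulVec 1 j :=
    mulVec_apply_pos (fun i k => hH k i) hcol (fun _ => one_pos)
  have hTx : ∀ j, x j * Hᵀ.mulVec (fun i => y i / H.mulVec x i) j =
      Hᵀ.mulVec 1 j * emMap H y x j := by
    intro j
    have := (hs j).ne'
    simp only [emMap]
    field_simp
  set z := emMap H y x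
  have hterm : ∀ i, y i * Real.log (y i / H.mulVec z i) + H.mulVec z i - y i ≤
      (y i * Real.log (y i / H.mulVec x i) + H.mulVec x i - y i) +
        (H.mulVec z i - H.mulVec x i -
          y i * ∑ j, H i j * x j / H.mulVec x i * Real.log (z j / x j)) := by
    intro i
    have ha := mulVec_apply_pos hH hrow hx i
    have hb := mulVec_apply_pos hH hrow hz i
    have h := mul_le_mul_of_nonneg_left (sum_mul_log_div_le hH hrow hx hz i) (hy i).le
    rw [Real.log_div hb.ne' ha.ne'] at h
    rw [Real.log_div (hy i).ne' hb.ne', Real.log_div (hy i).ne' ha.ne']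
    linarith
  have hswap : ∑ i, y i * ∑ j, H i j * x j / H.mulVec x i * Real.log (z j / x j) =
      ∑ j, Hᵀ.mulVec 1 j * z j * Real.log (z j / x j) := by
    simp only [Finset.mul_sum]
    rw [Finset.sum_comm]
    refine Finset.sum_congr rfl fun j _ => ?_
    rw [← hTx j, show Hᵀ.mulVec (fun i => y i / H.mulVec x i) j =
      ∑ i, H i j * (y i / H.mulVec x i) from rfl, Finset.mul_sum, Finset.sum_mul]
    exact Finset.sum_congr rfl fun i _ => by ring
  have hlog : ∀ j, Hᵀ.mulVec 1 j * z j - Hᵀ.mulVec 1 j * x j -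
      Hᵀ.mulVec 1 j * z j * Real.log (z j / x j) ≤ 0 := by
    intro j
    have h := mul_le_mul_of_nonneg_left
      (Real.one_sub_inv_le_log_of_pos (div_pos (hz j) (hx j))) (mul_pos (hs j) (hz j)).le
    have hcancel : Hᵀ.mulVec 1 j * z j * (1 - (z j / x j)⁻¹) =
        Hᵀ.mulVec 1 j * z j - Hᵀ.mulVec 1 j * x j := by
      have := (hz j).ne'
      field_simp
    linarith
  have hsum := Finset.sum_le_sum fun i (_ : i ∈ Finset.univ) => hterm i
  rw [Finset.sum_add_distrib] at hsum
  refine hsum.trans (add_le_of_nonpos_right ?_)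
  rw [Finset.sum_sub_distrib, Finset.sum_sub_distrib, hswap, sum_mulVec, sum_mulVec,
    ← Finset.sum_sub_distrib, ← Finset.sum_sub_distrib]
  exact Finset.sum_nonpos fun j _ => hlog j

end EM

/-- monotone decrease of the Kullback–Leibler discrepancy along EM iterations:
`F(T(x)) ≤ F(x)` for every strictly positive `x`; in particular the sequence `F(x_k)` along EM
iterates started from a strictly positive `x₀` is nonincreasing. -/
theorem kl_decreases_along_em (N : ℕ) (H : Matrix (Fin N) (Fin N) ℝ)
    (y : Fin N → ℝ) (hy : ∀ i, 0 < y i)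
    (hH : ∀ i j, 0 ≤ H i j)
    (hrow : ∀ i, ∃ j, 0 < H i j)
    (hcol : ∀ j, ∃ i, 0 < H i j) :
    (∀ x : Fin N → ℝ, (∀ j, 0 < x j) → klF H y (emMap H y x) ≤ klF H y x) ∧
    (∀ xs : ℕ → Fin N → ℝ, (∀ j, 0 < xs 0 j) → (∀ k, xs (k + 1) = emMap H y (xs k)) →
      ∀ k, klF H y (xs (k + 1)) ≤ klF H y (xs k)) := by
  refine ⟨fun x hx => klF_emMap_le hy hH hrow hcol hx, fun xs h0 hstep k => ?_⟩
  have hpos : ∀ k j, 0 < xs k j := by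
    intro k
    induction k with
    | zero => exact h0
    | succ k ih =>
      rw [hstep k]
      exact emMap_apply_pos hy hH hrow hcol ih
  rw [hstep k]
  exact klF_emMap_le hy hH hrow hcol (hpos k)
end
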